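/- For every x > 0, the three-function Wronskian satisfies W[φ̃₁^I(·;53/2), φ̃₁^II(·;53/2), φ̃₂^II(·;53/2)](x) = −4 e^{−x²/2} x^{−51/2} (30 + x²)³ (390 + 39x² + x⁴). -/

import Mathlib

/-- The degree-`v` generalized Laguerre polynomial `L_v^{(α)}(y)` for `v ∈ {1,2,3}`. -/
noncomputable def Lv (v : ℕ) (α y : ℝ) : ℝ :=
  if v = 1 then α + 1 - y
  else if v = 2 then ((α+1)*(α+2) - 2*(α+2)*y + y^2)/2
  else ((α+1)*(α+2)*(α+3) - 3*(α+2)*(α+3)*y + 3*(α+3)*y^2 - y^3)/6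

/-- Type I seed function `φ̃_v^I(x;g) = e^{x²/2} x^g L_v^{(g-1/2)}(-x²)`. -/
noncomputable def seedI (v : ℕ) (g x : ℝ) : ℝ :=
  Real.exp (x^2/2) * x ^ g * Lv v (g - 1/2) (-x^2)

/-- Type II seed function `φ̃_v^II(x;g) = e^{-x²/2} x^{1-g} L_v^{(1/2-g)}(x²)`. -/
noncomputable def seedII (v : ℕ) (g x : ℝ) : ℝ :=
  Real.exp (-x^2/2) * x ^ (1-g) * Lv v (1/2 - g) (x^2)

/-- Type III seed function `φ̃_v^III(x;g) = e^{x²/2} x^{1-g} L_v^{(1/2-g)}(-x²)`. -/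
noncomputable def seedIII (v : ℕ) (g x : ℝ) : ℝ :=
  Real.exp (x^2/2) * x ^ (1-g) * Lv v (1/2 - g) (-x^2)

/-- The Wronskian `W[f,g](x) = f(x)g'(x) - f'(x)g(x)`. -/
noncomputable def Wr (f g : ℝ → ℝ) (x : ℝ) : ℝ :=
  f x * deriv g x - deriv f x * g x

/-- The three-function Wronskian
`W[f₁,f₂,f₃](x) = det (dⁱ⁻¹fⱼ/dxⁱ⁻¹)_{1 ≤ i,j ≤ 3}`. -/
noncomputable def Wr3 (f1 f2 f3 : ℝ → ℝ) (x : ℝ) : ℝ :=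
  Matrix.det
    !![f1 x, f2 x, f3 x;
       deriv f1 x, deriv f2 x, deriv f3 x;
       deriv (deriv f1) x, deriv (deriv f2) x, deriv (deriv f3) x]

/-- The logarithmic-derivative form of the product rule for `e^{s x²/2} x^a p(x)`. -/
theorem hasDerivAt_exp_mul_rpow_mul (s a : ℝ) {p : ℝ → ℝ} {p' x : ℝ} (hx : 0 < x)
    (hp : HasDerivAt p p' x) :
    HasDerivAt (fun y => Real.exp (s * y ^ 2 / 2) * y ^ a * p y)
      (Real.exp (s * x ^ 2 / 2) * x ^ a * (p' + (s * x + a / x) * p x)) x := by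
  have hexp : HasDerivAt (fun y : ℝ => Real.exp (s * y ^ 2 / 2))
      (Real.exp (s * x ^ 2 / 2) * (s * x)) x := by
    convert! ((((hasDerivAt_id x).pow 2).const_mul s).div_const 2).exp using 1
    simp only [id, Pi.pow_apply]
    push_cast
    ring
  have hpow := Real.hasDerivAt_rpow_const (x := x) (p := a) (Or.inl hx.ne')
  refine ((hexp.mul hpow).mul hp).congr_deriv ?_
  rw [Real.rpow_sub_one hx.ne', Pi.mul_apply]
  ring

/-- First and second derivatives of `e^{s x²/2} x^a p(x)` on the positive half-line. -/
theorem deriv_and_deriv_deriv_exp_mul_rpow_mul (s a : ℝ) {p p' p'' : ℝ → ℝ}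
    (hp : ∀ y, HasDerivAt p (p' y) y) (hp' : ∀ y, HasDerivAt p' (p'' y) y)
    {f : ℝ → ℝ} (hf : f = fun y => Real.exp (s * y ^ 2 / 2) * y ^ a * p y)
    {x : ℝ} (hx : 0 < x) :
    deriv f x = Real.exp (s * x ^ 2 / 2) * x ^ a * (p' x + (s * x + a / x) * p x) ∧
    deriv (deriv f) x = Real.exp (s * x ^ 2 / 2) * x ^ a *
      (p'' x + 2 * (s * x + a / x) * p' x + ((s * x + a / x) ^ 2 + s - a / x ^ 2) * p x) := by
  subst hf
  have hd : ∀ y, 0 < y → deriv (fun y => Real.exp (s * y ^ 2 / 2) * y ^ a * p y) y =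
      Real.exp (s * y ^ 2 / 2) * y ^ a * (p' y + (s * y + a / y) * p y) :=
    fun y hy => (hasDerivAt_exp_mul_rpow_mul s a hy (hp y)).deriv
  refine ⟨hd x hx, ?_⟩
  have hu : HasDerivAt (fun y : ℝ => s * y + a / y) (s - a / x ^ 2) x := by
    have h := ((hasDerivAt_id x).const_mul s).add ((hasDerivAt_inv hx.ne').const_mul a)
    refine (h.congr_deriv ?_).congr_of_eventuallyEq (Filter.Eventually.of_forall fun y => ?_)
    · ring
    · simp [div_eq_mul_inv]
  rw [Filter.EventuallyEq.deriv_eq ((eventually_gt_nhds hx).mono hd),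
    (hasDerivAt_exp_mul_rpow_mul s a (p := fun y => p' y + (s * y + a / y) * p y) hx
      ((hp' x).add (hu.mul (hp x)))).deriv]
  ring

/-- the three-index seed solution of case (H):
`W[φ̃₁^I(·;53/2), φ̃₁^II(·;53/2), φ̃₂^II(·;53/2)](x)
  = −4 e^{−x²/2} x^{−51/2} (30+x²)³ (390+39x²+x⁴)`. -/
theorem wronskian_H_three_index (x : ℝ) (hx : 0 < x) :
    Wr3 (seedI 1 (53/2)) (seedII 1 (53/2)) (seedII 2 (53/2)) x
      = -4 * Real.exp (-x^2/2) * x ^ (-(51:ℝ)/2) * (30 + x^2)^3 * (390 + 39*x^2 + x^4) := by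
  have e1 : seedI 1 (53/2) =
      fun y => Real.exp (1 * y ^ 2 / 2) * y ^ (53/2 : ℝ) * (27 + y ^ 2) := by
    ext y
    simp only [seedI, Lv, if_true, one_mul]
    ring
  have e2 : seedII 1 (53/2) =
      fun y => Real.exp (-1 * y ^ 2 / 2) * y ^ (-51/2 : ℝ) * (-25 - y ^ 2) := by
    ext y
    norm_num [seedII, Lv]
  have e3 : seedII 2 (53/2) =
      fun y => Real.exp (-1 * y ^ 2 / 2) * y ^ (-51/2 : ℝ) * (300 + 24 * y ^ 2 + y ^ 4 / 2) := by
    ext y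
    norm_num [seedII, Lv]
    exact Or.inl (by ring)
  obtain ⟨d1, dd1⟩ := deriv_and_deriv_deriv_exp_mul_rpow_mul 1 (53/2)
    (p := fun y => 27 + y ^ 2) (p' := fun y => 2 * y) (p'' := fun _ => 2)
    (fun y => by simpa using (hasDerivAt_pow 2 y).const_add 27)
    (fun y => by simpa using (hasDerivAt_id y).const_mul 2) e1 hx
  obtain ⟨d2, dd2⟩ := deriv_and_deriv_deriv_exp_mul_rpow_mul (-1) (-51/2)
    (p := fun y => -25 - y ^ 2) (p' := fun y => -2 * y) (p'' := fun _ => -2)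
    (fun y => by simpa using (hasDerivAt_pow 2 y).const_sub (-25))
    (fun y => by simpa using (hasDerivAt_id y).const_mul (-2)) e2 hx
  obtain ⟨d3, dd3⟩ := deriv_and_deriv_deriv_exp_mul_rpow_mul (-1) (-51/2)
    (p := fun y => 300 + 24 * y ^ 2 + y ^ 4 / 2) (p' := fun y => 48 * y + 2 * y ^ 3)
    (p'' := fun y => 48 + 6 * y ^ 2)
    (fun y => by
      refine ((((hasDerivAt_pow 2 y).const_mul 24).const_add 300).add
        ((hasDerivAt_pow 4 y).div_const 2)).congr_deriv ?_
      norm_num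
      ring)
    (fun y => by
      refine (((hasDerivAt_id y).const_mul 48).add
        ((hasDerivAt_pow 3 y).const_mul 2)).congr_deriv ?_
      norm_num
      ring) e3 hx
  have hexp : Real.exp (1 * x ^ 2 / 2) * Real.exp (-1 * x ^ 2 / 2) = 1 := by
    rw [← Real.exp_add, ← Real.exp_zero]
    ring_nf
  have hrpow : x ^ (53/2 : ℝ) * x ^ (-51/2 : ℝ) = x := by
    rw [← Real.rpow_add hx]
    norm_num
  have hfactor : Real.exp (1 * x ^ 2 / 2) * x ^ (53/2 : ℝ) *
      (Real.exp (-1 * x ^ 2 / 2) * x ^ (-51/2 : ℝ)) ^ 2 =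
      x * (Real.exp (-1 * x ^ 2 / 2) * x ^ (-51/2 : ℝ)) := by
    linear_combination (x ^ (53/2 : ℝ) * x ^ (-51/2 : ℝ) * Real.exp (-1 * x ^ 2 / 2) *
      x ^ (-51/2 : ℝ)) * hexp + Real.exp (-1 * x ^ 2 / 2) * x ^ (-51/2 : ℝ) * hrpow
  rw [Wr3, Matrix.det_fin_three, d1, d2, d3, dd1, dd2, dd3, e1, e2, e3]
  simp only [Matrix.of_apply, Matrix.cons_val', Matrix.cons_val_zero, Matrix.cons_val_one,
    Matrix.cons_val, Matrix.cons_val_fin_one]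
  rw [show -x ^ 2 / 2 = -1 * x ^ 2 / 2 by ring]
  generalize Real.exp (1 * x ^ 2 / 2) * x ^ (53/2 : ℝ) = A at *
  have hassoc : -4 * Real.exp (-1 * x ^ 2 / 2) * x ^ (-51/2 : ℝ) * (30 + x ^ 2) ^ 3 *
      (390 + 39 * x ^ 2 + x ^ 4) = -4 * (Real.exp (-1 * x ^ 2 / 2) * x ^ (-51/2 : ℝ)) *
      (30 + x ^ 2) ^ 3 * (390 + 39 * x ^ 2 + x ^ 4) := by ring
  rw [hassoc]
  generalize Real.exp (-1 * x ^ 2 / 2) * x ^ (-51/2 : ℝ) = B at *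
  have hx0 := hx.ne'
  trans A * B ^ 2 * (-4 * (30 + x ^ 2) ^ 3 * (390 + 39 * x ^ 2 + x ^ 4) / x)
  · field_simp
    ring
  · rw [hfactor]
    field_simp
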